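/- Let f_1,...,f_k be binary forms of degree n spanning a k-dimensional subspace. The intersection of the kernels of the catalecticant maps Cat_{f_i}(2, n-2): T_{n-2} → S_2 is nonzero if and only if there exist pairwise non-proportional linear forms L_1,...,L_m and positive integers g_1,...,g_m with ∑ g_j = n-2 such that every f_i admits a GAD f_i = ∑_{j=1}^m G_{i,j}·L_j^{n-g_j+1} with deg G_{i,j} = g_j - 1 (a 'similar GAD', i.e., with the same linear forms and multiplicities for all i). -/

import Mathlib

open MvPolynomial

noncomputable def contractOp (φ f : MvPolynomial (Fin 2) ℂ) : MvPolynomial (Fin 2) ℂ :=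
  φ.support.sum fun m =>
    φ.coeff m • ((fun p => pderiv (0 : Fin 2) p)^[m 0]
      ((fun p => pderiv (1 : Fin 2) p)^[m 1] f))

def IsLinearForm (L : MvPolynomial (Fin 2) ℂ) : Prop := L ≠ 0 ∧ L.IsHomogeneous 1

def Proportional (L L' : MvPolynomial (Fin 2) ℂ) : Prop := ∃ c : ℂ, L' = c • L

def IsGAD (n : ℕ) (f : MvPolynomial (Fin 2) ℂ) (m : ℕ)
    (L : Fin m → MvPolynomial (Fin 2) ℂ) (g : Fin m → ℕ)
    (G : Fin m → MvPolynomial (Fin 2) ℂ) : Prop :=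
  (∀ i, IsLinearForm (L i)) ∧
  (∀ i j, i ≠ j → ¬ Proportional (L i) (L j)) ∧
  (∀ i, 1 ≤ g i) ∧
  (∀ i, (G i).IsHomogeneous (g i - 1)) ∧
  f = ∑ i, G i * (L i) ^ (n - g i + 1)

def HasGADLength (n : ℕ) (f : MvPolynomial (Fin 2) ℂ) (s : ℕ) : Prop :=
  ∃ m L g G, IsGAD n f m L g G ∧ ∑ i, g i = s

/-- The derivation `a ∂₀ + b ∂₁` attached to the dual linear form `a X₀ + b X₁`. -/
noncomputable def dirDeriv (a b : ℂ) :
    Derivation ℂ (MvPolynomial (Fin 2) ℂ) (MvPolynomial (Fin 2) ℂ) :=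
  a • pderiv 0 + b • pderiv 1

/-- The linear form `b X₀ - a X₁` annihilated by `a ∂₀ + b ∂₁`. -/
noncomputable def perpForm (a b : ℂ) : MvPolynomial (Fin 2) ℂ := b • X 0 - a • X 1

lemma dirDeriv_apply (a b : ℂ) (f : MvPolynomial (Fin 2) ℂ) :
    dirDeriv a b f = a • pderiv 0 f + b • pderiv 1 f := rfl

lemma dirDeriv_perpForm (a b c d : ℂ) : dirDeriv a b (perpForm c d) = C (a * d - b * c) := by
  simp [dirDeriv_apply, perpForm, smul_eq_C_mul]
  ring

lemma dirDeriv_perpForm_self (a b : ℂ) : dirDeriv a b (perpForm a b) = 0 := by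
  rw [dirDeriv_perpForm, mul_comm, sub_self, C_0]

lemma pderiv_comm_apply {σ : Type*} (i j : σ) (f : MvPolynomial σ ℂ) :
    pderiv i (pderiv j f) = pderiv j (pderiv i f) := by
  classical
  have h : ⁅(pderiv i : Derivation ℂ (MvPolynomial σ ℂ) (MvPolynomial σ ℂ)),
      (pderiv j : Derivation ℂ (MvPolynomial σ ℂ) (MvPolynomial σ ℂ))⁆ = 0 := by
    refine MvPolynomial.derivation_ext fun k => ?_
    simp [Derivation.commutator_apply, pderiv_X, Pi.single_apply, apply_ite]
  have := congrArg (fun D : Derivation ℂ _ _ => D f) h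
  simpa [Derivation.commutator_apply, sub_eq_zero] using this

lemma dirDeriv_comm (a b c d : ℂ) (f : MvPolynomial (Fin 2) ℂ) :
    dirDeriv a b (dirDeriv c d f) = dirDeriv c d (dirDeriv a b f) := by
  simp only [dirDeriv_apply, map_add, Derivation.map_smul, smul_add,
    pderiv_comm_apply (1 : Fin 2) 0, smul_smul, mul_comm]
  abel

lemma smul_isHomogeneous {f : MvPolynomial (Fin 2) ℂ} {n : ℕ} (h : f.IsHomogeneous n) (c : ℂ) :
    (c • f).IsHomogeneous n := by
  rw [smul_eq_C_mul]; exact h.C_mul c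

lemma dirDeriv_isHomogeneous {f : MvPolynomial (Fin 2) ℂ} {n : ℕ} (h : f.IsHomogeneous n)
    (a b : ℂ) : (dirDeriv a b f).IsHomogeneous (n - 1) :=
  (smul_isHomogeneous h.pderiv a).add (smul_isHomogeneous h.pderiv b)

lemma dirDeriv_iterate_isHomogeneous {f : MvPolynomial (Fin 2) ℂ} {n : ℕ}
    (h : f.IsHomogeneous n) (a b : ℂ) (g : ℕ) :
    ((dirDeriv a b)^[g] f).IsHomogeneous (n - g) := by
  induction g with
  | zero => exact h
  | succ g ih =>
    rw [Function.iterate_succ_apply', ← Nat.sub_sub]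
    exact dirDeriv_isHomogeneous ih a b

lemma perpForm_ne_zero {a b : ℂ} (hab : a ≠ 0 ∨ b ≠ 0) : perpForm a b ≠ 0 := by
  intro hM
  have h1 := dirDeriv_perpForm 1 0 a b
  have h2 := dirDeriv_perpForm 0 1 a b
  simp only [hM, map_zero, eq_comm (a := (0 : MvPolynomial (Fin 2) ℂ)), C_eq_zero] at h1 h2
  simp_all

lemma perpForm_isHomogeneous (a b : ℂ) : (perpForm a b).IsHomogeneous 1 :=
  (smul_isHomogeneous (isHomogeneous_X _ _) b).sub (smul_isHomogeneous (isHomogeneous_X _ _) a)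

lemma perpForm_pow_isHomogeneous (a b : ℂ) (n : ℕ) : ((perpForm a b) ^ n).IsHomogeneous n := by
  simpa using (perpForm_isHomogeneous a b).pow n

lemma exists_eq_C_of_isHomogeneous_zero {f : MvPolynomial (Fin 2) ℂ} (h : f.IsHomogeneous 0) :
    ∃ c, f = C c :=
  ⟨_, totalDegree_eq_zero_iff_eq_C.mp (Nat.le_zero.mp h.totalDegree_le)⟩

lemma dirDeriv_eq_zero_of_isHomogeneous_zero {f : MvPolynomial (Fin 2) ℂ}
    (h : f.IsHomogeneous 0) (a b : ℂ) : dirDeriv a b f = 0 := by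
  obtain ⟨c, rfl⟩ := exists_eq_C_of_isHomogeneous_zero h
  simp

lemma dirDeriv_iterate_eq_zero {f : MvPolynomial (Fin 2) ℂ} {n : ℕ} (h : f.IsHomogeneous n)
    (a b : ℂ) : (dirDeriv a b)^[n + 1] f = 0 := by
  rw [Function.iterate_succ_apply']
  refine dirDeriv_eq_zero_of_isHomogeneous_zero ?_ a b
  simpa using dirDeriv_iterate_isHomogeneous h a b n

/-- A binary form killed by a nonzero derivation `a ∂₀ + b ∂₁` is a multiple of a power of the
perpendicular linear form. -/
lemma exists_eq_smul_perpForm_pow {a b : ℂ} (hab : a ≠ 0 ∨ b ≠ 0) {n : ℕ}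
    {f : MvPolynomial (Fin 2) ℂ} (h : f.IsHomogeneous n) (h0 : dirDeriv a b f = 0) :
    ∃ c : ℂ, f = c • perpForm a b ^ n := by
  induction n generalizing f with
  | zero =>
    obtain ⟨c, rfl⟩ := exists_eq_C_of_isHomogeneous_zero h
    exact ⟨c, by simp [smul_eq_C_mul]⟩
  | succ n ih =>
    have hD (i : Fin 2) : dirDeriv a b (pderiv i f) = 0 := by
      have := congrArg (pderiv i) h0
      simpa [dirDeriv_apply, pderiv_comm_apply i] using this
    obtain ⟨c, hc⟩ := ih (f := pderiv 0 f) h.pderiv (hD 0)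
    obtain ⟨d, hd⟩ := ih (f := pderiv 1 f) h.pderiv (hD 1)
    have hE := h.sum_X_mul_pderiv
    rw [Fin.sum_univ_two, hc, hd, nsmul_eq_mul] at hE
    have hn : ((n : ℂ) + 1) ≠ 0 := by exact_mod_cast n.succ_ne_zero
    have hcd : a * c + b * d = 0 := by
      rw [dirDeriv_apply, hc, hd, smul_smul, smul_smul, ← add_smul] at h0
      exact (smul_eq_zero.mp h0).resolve_right (pow_ne_zero _ (perpForm_ne_zero hab))
    obtain ⟨t, rfl, rfl⟩ : ∃ t, c = t * b ∧ d = -(t * a) := by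
      by_cases ha : a = 0
      · have hb : b ≠ 0 := by tauto
        refine ⟨c / b, by field_simp, ?_⟩
        subst ha
        simpa [hb] using hcd
      · refine ⟨- d / a, ?_, by field_simp⟩
        field_simp
        linear_combination hcd
    refine ⟨t / (n + 1), ?_⟩
    have hinj : Function.Injective (C ((n : ℂ) + 1) * · : MvPolynomial (Fin 2) ℂ → _) :=
      mul_right_injective₀ (by rwa [Ne, C_eq_zero])
    apply hinj
    have : C ((n : ℂ) + 1) * (t / (n + 1)) • perpForm a b ^ (n + 1)
        = C t * perpForm a b ^ (n + 1) := by
      rw [smul_eq_C_mul, ← mul_assoc, ← C_mul, mul_div_cancel₀ _ hn]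
    simp only [this]
    have h3 : (C ((n : ℂ) + 1) : MvPolynomial (Fin 2) ℂ) = ((n + 1 : ℕ) : _) := by simp
    rw [h3, ← hE, pow_succ]
    nth_rewrite 4 [perpForm]
    simp only [smul_eq_C_mul, map_mul, map_neg]
    ring

lemma dirDeriv_mul (a b : ℂ) (f g : MvPolynomial (Fin 2) ℂ) :
    dirDeriv a b (f * g) = f * dirDeriv a b g + g * dirDeriv a b f := by
  simp [Derivation.leibniz]

lemma dirDeriv_pow (a b : ℂ) (f : MvPolynomial (Fin 2) ℂ) (n : ℕ) :
    dirDeriv a b (f ^ n) = (n : ℂ) • (f ^ (n - 1) * dirDeriv a b f) := by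
  simp [Derivation.leibniz_pow, smul_eq_C_mul]

lemma exists_dirDeriv_eq_one {a b : ℂ} (hab : a ≠ 0 ∨ b ≠ 0) :
    ∃ N : MvPolynomial (Fin 2) ℂ, N.IsHomogeneous 1 ∧ dirDeriv a b N = 1 := by
  rcases hab with h | h
  · refine ⟨a⁻¹ • X 0, smul_isHomogeneous (isHomogeneous_X _ _) _, ?_⟩
    simp [dirDeriv_apply, h]
  · refine ⟨b⁻¹ • X 1, smul_isHomogeneous (isHomogeneous_X _ _) _, ?_⟩
    simp [dirDeriv_apply, h]

lemma exists_dirDeriv_eq {a b : ℂ} (hab : a ≠ 0 ∨ b ≠ 0) {n : ℕ}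
    {h : MvPolynomial (Fin 2) ℂ} (hh : h.IsHomogeneous n) :
    ∃ F : MvPolynomial (Fin 2) ℂ, F.IsHomogeneous (n + 1) ∧ dirDeriv a b F = h := by
  obtain ⟨N, hN, hDN⟩ := exists_dirDeriv_eq_one hab
  suffices H : ∀ i : ℕ, ∃ F : MvPolynomial (Fin 2) ℂ,
      F.IsHomogeneous (n + 1 + i) ∧ dirDeriv a b F = N ^ i * h by simpa using H 0
  have hD (i : ℕ) (h : MvPolynomial (Fin 2) ℂ) :
      dirDeriv a b (((i : ℂ) + 1)⁻¹ • (N ^ (i + 1) * h)) =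
        N ^ i * h + ((i : ℂ) + 1)⁻¹ • (N ^ (i + 1) * dirDeriv a b h) := by
    have hi : ((i : ℂ) + 1) ≠ 0 := by exact_mod_cast i.succ_ne_zero
    rw [Derivation.map_smul, dirDeriv_mul, dirDeriv_pow, hDN, mul_one, add_tsub_cancel_right,
      smul_add, add_comm, mul_smul_comm, smul_smul]
    push_cast
    rw [inv_mul_cancel₀ hi, one_smul, mul_comm]
  have hHom {e : ℕ} (i : ℕ) {h : MvPolynomial (Fin 2) ℂ} (hh : h.IsHomogeneous e) :
      (((i : ℂ) + 1)⁻¹ • (N ^ (i + 1) * h)).IsHomogeneous (e + 1 + i) := by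
    refine smul_isHomogeneous ?_ _
    convert (hN.pow (i + 1)).mul hh using 1
    ring
  induction n generalizing h with
  | zero =>
    intro i
    refine ⟨_, hHom i hh, ?_⟩
    rw [hD, dirDeriv_eq_zero_of_isHomogeneous_zero hh]
    simp
  | succ n ih =>
    intro i
    obtain ⟨F, hF, hDF⟩ := ih (h := dirDeriv a b h) (dirDeriv_isHomogeneous hh a b) (i + 1)
    refine ⟨_, (hHom i hh).sub (smul_isHomogeneous (c := ((i : ℂ) + 1)⁻¹)
      (by convert hF using 1; ring)), ?_⟩
    rw [map_sub, hD, Derivation.map_smul, hDF, add_sub_cancel_right]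

lemma dirDeriv_mul_perpForm_pow (a b : ℂ) (G : MvPolynomial (Fin 2) ℂ) (e : ℕ) :
    dirDeriv a b (G * perpForm a b ^ e) = dirDeriv a b G * perpForm a b ^ e := by
  rw [dirDeriv_mul, dirDeriv_pow, dirDeriv_perpForm_self]
  simp [mul_comm]

lemma dirDeriv_iterate_mul_perpForm_pow (a b : ℂ) (G : MvPolynomial (Fin 2) ℂ) (e g : ℕ) :
    (dirDeriv a b)^[g] (G * perpForm a b ^ e) = (dirDeriv a b)^[g] G * perpForm a b ^ e := by
  induction g generalizing G with
  | zero => rfl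
  | succ g ih =>
    rw [Function.iterate_succ_apply, Function.iterate_succ_apply, dirDeriv_mul_perpForm_pow, ih]

lemma exists_eq_mul_perpForm_pow {a b : ℂ} (hab : a ≠ 0 ∨ b ≠ 0) {n g : ℕ} (hg : g ≤ n)
    {F : MvPolynomial (Fin 2) ℂ} (hF : F.IsHomogeneous n)
    (h0 : (dirDeriv a b)^[g + 1] F = 0) :
    ∃ G : MvPolynomial (Fin 2) ℂ, G.IsHomogeneous g ∧ F = G * perpForm a b ^ (n - g) := by
  induction g generalizing n F with
  | zero =>
    obtain ⟨c, rfl⟩ := exists_eq_smul_perpForm_pow hab hF h0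
    exact ⟨C c, isHomogeneous_C _ _, by simp [smul_eq_C_mul]⟩
  | succ g ih =>
    obtain ⟨n, rfl⟩ : ∃ k, n = k + 1 := ⟨n - 1, by omega⟩
    obtain ⟨G, hG, hDG⟩ := ih (n := n) (by omega) (dirDeriv_isHomogeneous hF a b) h0
    obtain ⟨G', hG', rfl⟩ := exists_dirDeriv_eq hab hG
    have hd : (F - G' * perpForm a b ^ (n - g)).IsHomogeneous (n + 1) := by
      refine hF.sub ?_
      have := hG'.mul (perpForm_pow_isHomogeneous a b (n - g))
      rwa [show g + 1 + (n - g) = n + 1 by omega] at this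
    obtain ⟨c, hc⟩ := exists_eq_smul_perpForm_pow hab hd
      (by rw [map_sub, dirDeriv_mul_perpForm_pow, hDG, sub_self])
    refine ⟨G' + c • perpForm a b ^ (g + 1),
      hG'.add (smul_isHomogeneous (perpForm_pow_isHomogeneous _ _ _) _), ?_⟩
    rw [sub_eq_iff_eq_add'] at hc
    rw [hc, add_mul, smul_mul_assoc, ← pow_add]
    rw [Nat.add_sub_add_right, show g + 1 + (n - g) = n + 1 by omega]

lemma dirDeriv_iterate_comm (a b c d : ℂ) (g : ℕ) (f : MvPolynomial (Fin 2) ℂ) :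
    (dirDeriv a b)^[g] (dirDeriv c d f) = dirDeriv c d ((dirDeriv a b)^[g] f) :=
  Function.Commute.iterate_left (fun f => dirDeriv_comm a b c d f) g f

/-- The contraction action on monomials, as a linear map into the differential operators. -/
noncomputable def contractLin :
    MvPolynomial (Fin 2) ℂ →ₗ[ℂ] Module.End ℂ (MvPolynomial (Fin 2) ℂ) :=
  (basisMonomials (Fin 2) ℂ).constr ℂ fun m =>
    ((pderiv 0 : Derivation ℂ (MvPolynomial (Fin 2) ℂ) _) : Module.End ℂ _) ^ m 0 *
      ((pderiv 1 : Derivation ℂ (MvPolynomial (Fin 2) ℂ) _) : Module.End ℂ _) ^ m 1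

lemma contractLin_monomial (m : Fin 2 →₀ ℕ) (c : ℂ) :
    contractLin (monomial m c) =
      c • (((pderiv 0 : Derivation ℂ (MvPolynomial (Fin 2) ℂ) _) : Module.End ℂ _) ^ m 0 *
      ((pderiv 1 : Derivation ℂ (MvPolynomial (Fin 2) ℂ) _) : Module.End ℂ _) ^ m 1) := by
  have h : (monomial m c : MvPolynomial (Fin 2) ℂ) = c • basisMonomials (Fin 2) ℂ m := by
    simp [smul_monomial]
  rw [h, map_smul, contractLin, Module.Basis.constr_basis]

lemma contractOp_eq_contractLin (φ f : MvPolynomial (Fin 2) ℂ) :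
    contractOp φ f = contractLin φ f := by
  conv_rhs => rw [φ.as_sum]
  simp only [contractOp, map_sum, LinearMap.sum_apply, contractLin_monomial, LinearMap.smul_apply,
    Module.End.mul_apply, Module.End.pow_apply]
  rfl

/-- The apolarity action as an algebra homomorphism into the differential operators. -/
noncomputable def contractAlg :
    MvPolynomial (Fin 2) ℂ →ₐ[ℂ] Module.End ℂ (MvPolynomial (Fin 2) ℂ) :=
  AlgHom.ofLinearMap contractLin
    (by
      have h : (1 : MvPolynomial (Fin 2) ℂ) = monomial 0 1 := rfl
      rw [h, contractLin_monomial]; simp)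
    (by
      intro p q
      induction p using MvPolynomial.induction_on' with
      | add p₁ p₂ h₁ h₂ => rw [add_mul, map_add, map_add, add_mul, h₁, h₂]
      | monomial m c =>
        induction q using MvPolynomial.induction_on' with
        | add q₁ q₂ h₁ h₂ => rw [mul_add, map_add, map_add, mul_add, h₁, h₂]
        | monomial m' c' =>
          have hc : Commute
              ((pderiv 1 : Derivation ℂ (MvPolynomial (Fin 2) ℂ) (MvPolynomial (Fin 2) ℂ)) :
                Module.End ℂ (MvPolynomial (Fin 2) ℂ))
              ((pderiv 0 : Derivation ℂ (MvPolynomial (Fin 2) ℂ) (MvPolynomial (Fin 2) ℂ)) :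
                Module.End ℂ (MvPolynomial (Fin 2) ℂ)) :=
            LinearMap.ext (pderiv_comm_apply 1 0)
          rw [monomial_mul, contractLin_monomial, contractLin_monomial, contractLin_monomial,
            smul_mul_smul_comm, Finsupp.add_apply, Finsupp.add_apply, pow_add, pow_add,
            (hc.pow_pow (m 1) (m' 0)).mul_mul_mul_comm])

lemma contractOp_eq_contractAlg (φ f : MvPolynomial (Fin 2) ℂ) :
    contractOp φ f = contractAlg φ f :=
  contractOp_eq_contractLin φ f

/-- The linear form `a X₀ + b X₁`, acting by contraction as `a ∂₀ + b ∂₁`. -/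
noncomputable def dualForm (a b : ℂ) : MvPolynomial (Fin 2) ℂ := a • X 0 + b • X 1

lemma dualForm_isHomogeneous (a b : ℂ) : (dualForm a b).IsHomogeneous 1 :=
  (smul_isHomogeneous (isHomogeneous_X _ _) a).add (smul_isHomogeneous (isHomogeneous_X _ _) b)

lemma contractAlg_X (i : Fin 2) (f : MvPolynomial (Fin 2) ℂ) :
    contractAlg (X i) f = pderiv i f := by
  change contractLin (monomial _ 1) f = _
  rw [contractLin_monomial]
  fin_cases i <;> simp

lemma contractAlg_dualForm (a b : ℂ) (f : MvPolynomial (Fin 2) ℂ) :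
    contractAlg (dualForm a b) f = dirDeriv a b f := by
  simp [dualForm, dirDeriv_apply, contractAlg_X]

lemma contractAlg_dualForm_pow (a b : ℂ) (g : ℕ) (f : MvPolynomial (Fin 2) ℂ) :
    contractAlg (dualForm a b ^ g) f = (dirDeriv a b)^[g] f := by
  rw [map_pow, Module.End.pow_apply]
  congr 1
  exact funext (contractAlg_dualForm a b)

lemma dirDeriv_smul_perpForm_pow (a b c : ℂ) (n : ℕ) :
    dirDeriv a b (c • perpForm a b ^ n) = 0 := by
  rw [Derivation.map_smul, dirDeriv_pow, dirDeriv_perpForm_self]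
  simp

lemma dirDeriv_iterate_perpForm_pow {a b c d : ℂ} (h : a * d - b * c ≠ 0) {n k : ℕ}
    (hk : k ≤ n) :
    ∃ t : ℂ, t ≠ 0 ∧ (dirDeriv a b)^[k] (perpForm c d ^ n) = t • perpForm c d ^ (n - k) := by
  induction k with
  | zero => exact ⟨1, one_ne_zero, by simp⟩
  | succ k ih =>
    obtain ⟨t, ht, hD⟩ := ih (by omega)
    refine ⟨t * ((n - k : ℕ) * (a * d - b * c)),
      mul_ne_zero ht (mul_ne_zero (Nat.cast_ne_zero.mpr (by omega)) h), ?_⟩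
    rw [Function.iterate_succ_apply', hD, Derivation.map_smul, dirDeriv_pow, dirDeriv_perpForm,
      mul_comm _ (C _), ← smul_eq_C_mul, smul_smul, smul_smul, Nat.sub_sub,
      mul_assoc]

lemma exists_dirDeriv_eq_of_iterate_eq_zero {a b c d : ℂ} (hab : a ≠ 0 ∨ b ≠ 0)
    (h : c * b - d * a ≠ 0) {n g : ℕ} (hg : g ≤ n + 1) {H : MvPolynomial (Fin 2) ℂ}
    (hH : H.IsHomogeneous n) (hD : (dirDeriv c d)^[g] H = 0) :
    ∃ F : MvPolynomial (Fin 2) ℂ, F.IsHomogeneous (n + 1) ∧ dirDeriv a b F = H ∧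
      (dirDeriv c d)^[g] F = 0 := by
  obtain ⟨F, hF, rfl⟩ := exists_dirDeriv_eq hab hH
  rw [dirDeriv_iterate_comm] at hD
  obtain ⟨s, hs⟩ := exists_eq_smul_perpForm_pow hab (dirDeriv_iterate_isHomogeneous hF c d g) hD
  obtain ⟨t, ht, htD⟩ := dirDeriv_iterate_perpForm_pow h hg
  refine ⟨F + (-(s / t)) • perpForm a b ^ (n + 1),
    hF.add (smul_isHomogeneous (perpForm_pow_isHomogeneous _ _ _) _), ?_, ?_⟩
  · rw [map_add, dirDeriv_smul_perpForm_pow, add_zero]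
  · rw [iterate_map_add, hs, ← contractAlg_dualForm_pow c d, map_smul, contractAlg_dualForm_pow,
      htD, smul_smul, ← add_smul]
    field_simp
    simp

/-- A form killed by a product of powers of pairwise independent derivations is a sum of forms,
each killed by one of these powers. -/
lemma exists_sum_of_contractAlg_eq_zero {ι : Type*} [Fintype ι] {a b : ι → ℂ}
    (hab : ∀ j, a j ≠ 0 ∨ b j ≠ 0) (hne : ∀ i j, i ≠ j → a i * b j - b i * a j ≠ 0)
    {g : ι → ℕ} {n : ℕ} (hg : ∑ j, g j ≤ n) {f : MvPolynomial (Fin 2) ℂ}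
    (hf : f.IsHomogeneous n) (h0 : contractAlg (∏ j, dualForm (a j) (b j) ^ g j) f = 0) :
    ∃ F : ι → MvPolynomial (Fin 2) ℂ, (∀ j, (F j).IsHomogeneous n) ∧
      (∀ j, (dirDeriv (a j) (b j))^[g j] (F j) = 0) ∧ f = ∑ j, F j := by
  classical
  induction hd : ∑ j, g j generalizing g n f with
  | zero =>
    have hg0 : ∀ j, g j = 0 := by simpa using hd
    refine ⟨0, fun j => isHomogeneous_zero _ _ _, fun j => by simp [hg0], ?_⟩
    simpa [hg0] using h0
  | succ d ih =>
    obtain ⟨j₀, -, hj₀⟩ : ∃ j ∈ Finset.univ, g j ≠ 0 :=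
      Finset.exists_ne_zero_of_sum_ne_zero (by omega)
    obtain ⟨g, rfl⟩ : ∃ g', g = g' + Pi.single j₀ 1 := by
      refine ⟨g - Pi.single j₀ 1, (tsub_add_cancel_of_le ?_).symm⟩
      intro j
      by_cases hj : j = j₀
      · subst hj; simpa [Nat.one_le_iff_ne_zero] using hj₀
      · simp [hj]
    have hsum : ∑ j, (g + Pi.single j₀ 1 : ι → ℕ) j = ∑ j, g j + 1 := by
      simp [Finset.sum_add_distrib]
    have hprod : ∏ j, dualForm (a j) (b j) ^ (g + Pi.single j₀ 1 : ι → ℕ) j =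
        (∏ j, dualForm (a j) (b j) ^ g j) * dualForm (a j₀) (b j₀) := by
      simp only [Pi.add_apply, pow_add, Finset.prod_mul_distrib]
      congr 1
      refine (Finset.prod_eq_single j₀ (fun j _ hj => ?_) (by simp)).trans (by simp)
      rw [Pi.single_eq_of_ne hj, pow_zero]
    rw [hsum] at hg hd
    rw [hprod, map_mul, Module.End.mul_apply, contractAlg_dualForm] at h0
    obtain ⟨n, rfl⟩ : ∃ k, n = k + 1 := ⟨n - 1, by omega⟩
    obtain ⟨H, hH, hHD, hHs⟩ := ih (by omega) (dirDeriv_isHomogeneous hf _ _) h0 (by omega)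
    have key (j : ι) : ∃ F : MvPolynomial (Fin 2) ℂ, F.IsHomogeneous (n + 1) ∧
        dirDeriv (a j₀) (b j₀) F = H j ∧
        (dirDeriv (a j) (b j))^[(g + Pi.single j₀ 1 : ι → ℕ) j] F = 0 := by
      by_cases hj : j = j₀
      · subst hj
        obtain ⟨F, hF, hFD⟩ := exists_dirDeriv_eq (hab j) (hH j)
        refine ⟨F, hF, hFD, ?_⟩
        rw [Pi.add_apply, Pi.single_eq_same, Function.iterate_succ_apply, hFD, hHD]
      · have hle : g j ≤ ∑ j, g j := Finset.single_le_sum (by simp) (Finset.mem_univ j)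
        rw [Pi.add_apply, Pi.single_eq_of_ne hj]
        exact exists_dirDeriv_eq_of_iterate_eq_zero (hab j₀) (hne j j₀ hj) (by omega) (hH j) (hHD j)
    choose F hF hFD hFg using key
    obtain ⟨c, hc⟩ := exists_eq_smul_perpForm_pow (hab j₀)
      (hf.sub (IsHomogeneous.sum Finset.univ F _ fun j _ => hF j))
      (by rw [map_sub, map_sum, hHs, sub_eq_zero]
          exact Finset.sum_congr rfl fun j _ => (hFD j).symm)
    refine ⟨fun j => F j + if j = j₀ then c • perpForm (a j₀) (b j₀) ^ (n + 1) else 0, ?_, ?_, ?_⟩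
    · intro j
      refine (hF j).add ?_
      split_ifs
      · exact smul_isHomogeneous (perpForm_pow_isHomogeneous _ _ _) _
      · exact isHomogeneous_zero _ _ _
    · intro j
      dsimp only
      rw [iterate_map_add, hFg, zero_add]
      split_ifs with hj
      · subst hj
        rw [Pi.add_apply, Pi.single_eq_same, Function.iterate_succ_apply,
          dirDeriv_smul_perpForm_pow, iterate_map_zero]
      · rw [iterate_map_zero]
    · rw [Finset.sum_add_distrib, Finset.sum_ite_eq' Finset.univ j₀, if_pos (Finset.mem_univ _),
        ← hc, add_sub_cancel]

lemma homogenize_X_sub_C (r : ℂ) :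
    (Polynomial.X - Polynomial.C r).homogenize 1 = dualForm 1 (-r) := by
  simp [dualForm, smul_eq_C_mul, sub_eq_add_neg]

lemma homogenize_multiset_prod (s : Multiset ℂ) :
    (s.map fun r => Polynomial.X - Polynomial.C r).prod.homogenize s.card =
      (s.map fun r => dualForm 1 (-r)).prod := by
  induction s using Multiset.induction_on with
  | empty => simp
  | cons r s ih =>
    rw [Multiset.map_cons, Multiset.prod_cons, Multiset.map_cons, Multiset.prod_cons,
      Multiset.card_cons, add_comm, Polynomial.homogenize_mul, ih, homogenize_X_sub_C]
    · exact Polynomial.natDegree_X_sub_C_le r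
    · rw [Polynomial.natDegree_multiset_prod_X_sub_C_eq_card]

/-- The coefficients of a normalised linear form, indexed by the projective line. -/
def projCoeff : Option ℂ → ℂ × ℂ
  | none => (0, 1)
  | some r => (1, -r)

lemma projCoeff_ne_zero (t : Option ℂ) : (projCoeff t).1 ≠ 0 ∨ (projCoeff t).2 ≠ 0 := by
  cases t <;> simp [projCoeff]

lemma projCoeff_det_ne_zero {s t : Option ℂ} (h : s ≠ t) :
    (projCoeff s).1 * (projCoeff t).2 - (projCoeff s).2 * (projCoeff t).1 ≠ 0 := by
  cases s <;> cases t <;> simp_all [projCoeff, add_eq_zero_iff_eq_neg, eq_comm]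

/-- A nonzero binary form over `ℂ` factors into linear forms. -/
lemma exists_multiset_of_isHomogeneous {φ : MvPolynomial (Fin 2) ℂ} (hφ : φ ≠ 0) {d : ℕ}
    (h : φ.IsHomogeneous d) :
    ∃ (c : ℂ) (s : Multiset (Option ℂ)), c ≠ 0 ∧ s.card = d ∧
      φ = C c * (s.map fun t => dualForm (projCoeff t).1 (projCoeff t).2).prod := by
  obtain ⟨p, hp, rfl⟩ : ∃ p : Polynomial ℂ, p.natDegree ≤ d ∧ p.homogenize d = φ := by
    refine ⟨_, ?_, Polynomial.homogenize_eq_of_isHomogeneous h rfl⟩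
    simpa using aeval_natDegree_le φ h.totalDegree_le ![Polynomial.X, 1] (n := 1)
      (fun i => by fin_cases i <;> simp)
  have hp0 : p ≠ 0 := by rintro rfl; simp at hφ
  have hcard : p.roots.card = p.natDegree :=
    (IsAlgClosed.splits p).natDegree_eq_card_roots.symm
  refine ⟨p.leadingCoeff, p.roots.map some + Multiset.replicate (d - p.roots.card) none,
    by simpa using hp0, by simp; omega, ?_⟩
  conv_lhs => rw [← Polynomial.C_leadingCoeff_mul_prod_multiset_X_sub_C hcard]
  rw [Polynomial.homogenize_C_mul, ← mul_one (Multiset.prod _),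
    show d = p.roots.card + (d - p.roots.card) by omega, Polynomial.homogenize_mul,
    homogenize_multiset_prod]
  · simp [projCoeff, dualForm]
  · rw [Polynomial.natDegree_multiset_prod_X_sub_C_eq_card]
  · simp

lemma exists_prod_of_isHomogeneous {φ : MvPolynomial (Fin 2) ℂ} (hφ : φ ≠ 0) {d : ℕ}
    (h : φ.IsHomogeneous d) :
    ∃ (m : ℕ) (a b : Fin m → ℂ) (g : Fin m → ℕ) (c : ℂ), (∀ j, a j ≠ 0 ∨ b j ≠ 0) ∧
      (∀ i j, i ≠ j → a i * b j - b i * a j ≠ 0) ∧ (∀ j, 1 ≤ g j) ∧ ∑ j, g j = d ∧ c ≠ 0 ∧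
      φ = C c * ∏ j, dualForm (a j) (b j) ^ g j := by
  obtain ⟨c, s, hc, rfl, rfl⟩ := exists_multiset_of_isHomogeneous hφ h
  let e := s.toFinset.equivFin.symm
  refine ⟨s.toFinset.card, fun j => (projCoeff (e j)).1, fun j => (projCoeff (e j)).2,
    fun j => s.count (e j : Option ℂ), c, fun j => projCoeff_ne_zero _,
    fun i j hij => projCoeff_det_ne_zero ?_, fun j => ?_, ?_, hc, ?_⟩
  · exact fun he => hij (e.injective (Subtype.ext he))
  · exact Multiset.one_le_count_iff_mem.mpr (Multiset.mem_toFinset.mp (e j).2)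
  · rw [Equiv.sum_comp e fun t => s.count (t : Option ℂ),
      Finset.sum_coe_sort s.toFinset fun t => s.count t, Multiset.toFinset_sum_count_eq]
  · rw [Finset.prod_multiset_map_count, Equiv.prod_comp e fun t : s.toFinset =>
        dualForm (projCoeff t).1 (projCoeff t).2 ^ s.count (t : Option ℂ),
      Finset.prod_coe_sort s.toFinset fun t =>
        dualForm (projCoeff t).1 (projCoeff t).2 ^ s.count t]

lemma perpForm_isLinearForm {a b : ℂ} (hab : a ≠ 0 ∨ b ≠ 0) : IsLinearForm (perpForm a b) :=
  ⟨perpForm_ne_zero hab, perpForm_isHomogeneous a b⟩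

lemma not_proportional_perpForm {a b c d : ℂ} (h : a * d - b * c ≠ 0) :
    ¬ Proportional (perpForm a b) (perpForm c d) := by
  rintro ⟨k, hk⟩
  have := congrArg (dirDeriv a b) hk
  rw [Derivation.map_smul, dirDeriv_perpForm_self, smul_zero, dirDeriv_perpForm, C_eq_zero] at this
  exact h this

lemma IsLinearForm.exists_eq_perpForm {L : MvPolynomial (Fin 2) ℂ} (hL : IsLinearForm L) :
    ∃ a b : ℂ, (a ≠ 0 ∨ b ≠ 0) ∧ L = perpForm a b := by
  obtain ⟨h0, h⟩ := hL
  obtain ⟨b, hb⟩ := exists_eq_C_of_isHomogeneous_zero (h.pderiv (i := 0))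
  obtain ⟨a, ha⟩ := exists_eq_C_of_isHomogeneous_zero (h.pderiv (i := 1))
  have hE := h.sum_X_mul_pderiv
  rw [Fin.sum_univ_two, hb, ha, one_smul] at hE
  have hL : L = perpForm (-a) b := by
    rw [← hE, perpForm, smul_eq_C_mul, smul_eq_C_mul, C_neg]
    ring
  refine ⟨-a, b, ?_, hL⟩
  by_contra! hab
  exact h0 (by simp [hL, hab, perpForm])

lemma dualForm_ne_zero {a b : ℂ} (hab : a ≠ 0 ∨ b ≠ 0) : dualForm a b ≠ 0 := by
  have h : dualForm a b = perpForm (-b) a := by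
    simp [dualForm, perpForm]
  rw [h]
  exact perpForm_ne_zero (by simpa [or_comm] using hab)

lemma contractAlg_prod_mul_perpForm_pow_eq_zero {ι : Type*} [Fintype ι] (a b : ι → ℂ) (g : ι → ℕ)
    {j : ι} (hg : 1 ≤ g j) {G : MvPolynomial (Fin 2) ℂ} (hG : G.IsHomogeneous (g j - 1)) (e : ℕ) :
    contractAlg (∏ i, dualForm (a i) (b i) ^ g i) (G * perpForm (a j) (b j) ^ e) = 0 := by
  classical
  have hD := dirDeriv_iterate_eq_zero hG (a j) (b j)
  rw [Nat.sub_add_cancel hg] at hD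
  rw [← Finset.prod_erase_mul _ _ (Finset.mem_univ j), map_mul contractAlg, Module.End.mul_apply,
    contractAlg_dualForm_pow, dirDeriv_iterate_mul_perpForm_pow, hD, zero_mul, map_zero]

theorem similar_gad_lemma (n k : ℕ) (f : Fin k → MvPolynomial (Fin 2) ℂ)
    (hf : ∀ i, (f i).IsHomogeneous n) (hind : LinearIndependent ℂ f) :
    (∃ φ : MvPolynomial (Fin 2) ℂ, φ ≠ 0 ∧ φ.IsHomogeneous (n - 2) ∧
        ∀ i, contractOp φ (f i) = 0) ↔
      ∃ (m : ℕ) (L : Fin m → MvPolynomial (Fin 2) ℂ) (g : Fin m → ℕ),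
        (∀ j, IsLinearForm (L j)) ∧
        (∀ j j', j ≠ j' → ¬ Proportional (L j) (L j')) ∧
        (∀ j, 1 ≤ g j) ∧ (∑ j, g j = n - 2) ∧
        ∀ i, ∃ G : Fin m → MvPolynomial (Fin 2) ℂ,
          (∀ j, (G j).IsHomogeneous (g j - 1)) ∧
          f i = ∑ j, G j * (L j) ^ (n - g j + 1) := by
  constructor
  · rintro ⟨φ, hφ0, hφ, h⟩
    obtain ⟨m, a, b, g, c, hab, hne, hg, hsum, hc, rfl⟩ := exists_prod_of_isHomogeneous hφ0 hφ
    refine ⟨m, fun j => perpForm (a j) (b j), g, fun j => perpForm_isLinearForm (hab j),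
      fun i j hij => not_proportional_perpForm (hne i j hij), hg, hsum, fun i => ?_⟩
    have h0 := h i
    rw [contractOp_eq_contractAlg, ← smul_eq_C_mul, map_smul, LinearMap.smul_apply] at h0
    obtain ⟨F, hF, hFD, hFs⟩ := exists_sum_of_contractAlg_eq_zero hab hne
      (by omega) (hf i) ((smul_eq_zero.mp h0).resolve_left hc)
    have key (j : Fin m) : ∃ G : MvPolynomial (Fin 2) ℂ, G.IsHomogeneous (g j - 1) ∧
        F j = G * perpForm (a j) (b j) ^ (n - g j + 1) := by
      have hle : g j ≤ ∑ j, g j := Finset.single_le_sum (by simp) (Finset.mem_univ j)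
      have hj := hg j
      obtain ⟨G, hG, hFG⟩ := exists_eq_mul_perpForm_pow (hab j) (g := g j - 1) (by omega) (hF j)
        (by rw [Nat.sub_add_cancel hj]; exact hFD j)
      exact ⟨G, hG, by rw [hFG]; congr 2; omega⟩
    choose G hG hFG using key
    exact ⟨G, hG, hFs.trans (Finset.sum_congr rfl fun j _ => hFG j)⟩
  · rintro ⟨m, L, g, hL, -, hg, hsum, h⟩
    choose a b hab hLab using fun j => (hL j).exists_eq_perpForm
    refine ⟨∏ j, dualForm (a j) (b j) ^ g j,
      Finset.prod_ne_zero_iff.mpr fun j _ => pow_ne_zero _ (dualForm_ne_zero (hab j)), ?_,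
      fun i => ?_⟩
    · rw [← hsum]
      refine IsHomogeneous.prod _ _ _ fun j _ => ?_
      simpa using (dualForm_isHomogeneous (a j) (b j)).pow (g j)
    · obtain ⟨G, hG, hfG⟩ := h i
      rw [contractOp_eq_contractAlg, hfG, map_sum]
      refine Finset.sum_eq_zero fun j _ => ?_
      rw [hLab]
      exact contractAlg_prod_mul_perpForm_pow_eq_zero a b g (hg j) (hG j) _
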